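/- arXiv:hep-th/9512160 — 5 statements merged into one kernel-verified Lean document; each statement's English description precedes it below -/
import Mathlib

section
/- For every natural number l, if P(α,β) is a homogeneous polynomial of degree l in two variables satisfying α·∂²P/∂α² + β·∂²P/∂β² + ∂P/∂α + ∂P/∂β = 0 and P(1,−1) = 1, then P = 𝒟_l, where 𝒟_l(α,β) = C(2l,l)^{−1} · Σ_{k=0}^{l} C(l,k)² α^k (−β)^{l−k}. (Uniqueness part of the characterization (1.28a)–(1.28b); the PDE forces the coefficient recursion k² a_k = −(l−k+1)² a_{k−1}.) -/
noncomputable section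

/-- The homogeneous polynomial
𝒟_l(α,β) = C(2l,l)⁻¹ Σ_{k=0}^{l} C(l,k)² α^k (−β)^{l−k}. -/
def Dl (l : ℕ) (α β : ℝ) : ℝ :=
  ((Nat.choose (2 * l) l : ℝ))⁻¹ *
    ∑ k ∈ Finset.range (l + 1),
      (Nat.choose l k : ℝ) ^ 2 * α ^ k * (-β) ^ (l - k)

theorem deriv_sum_mul_pow {ι : Type*} (s : Finset ι) (c : ι → ℝ) (n : ι → ℕ) :
    (deriv fun x : ℝ => ∑ k ∈ s, c k * x ^ n k) =
      fun x => ∑ k ∈ s, (c k * n k) * x ^ (n k - 1) := by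
  funext x
  refine HasDerivAt.deriv ?_
  refine HasDerivAt.fun_sum fun k _ => ?_
  simpa [mul_assoc] using (hasDerivAt_pow (n k) x).const_mul (c k)

theorem mul_deriv_deriv_add_deriv_sum_mul_pow {ι : Type*} (s : Finset ι) (c : ι → ℝ)
    (n : ι → ℕ) (x : ℝ) :
    x * deriv (deriv fun x : ℝ => ∑ k ∈ s, c k * x ^ n k) x +
        deriv (fun x : ℝ => ∑ k ∈ s, c k * x ^ n k) x =
      ∑ k ∈ s, c k * (n k : ℝ) ^ 2 * x ^ (n k - 1) := by
  rw [deriv_sum_mul_pow, deriv_sum_mul_pow, Finset.mul_sum, ← Finset.sum_add_distrib]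
  refine Finset.sum_congr rfl fun k _ => ?_
  rcases n k with _ | _ | m
  · simp
  · simp
  · simp only [Nat.add_sub_cancel]
    push_cast
    ring

theorem eq_zero_of_sum_mul_pow_eq_zero {l : ℕ} {c : ℕ → ℝ}
    (h : ∀ x : ℝ, ∑ k ∈ Finset.range l, c k * x ^ k = 0) {m : ℕ} (hm : m < l) : c m = 0 := by
  have hq : ∑ k ∈ Finset.range l, Polynomial.monomial k (c k) = 0 :=
    Polynomial.funext fun x => by simpa [Polynomial.eval_finsetSum] using h x
  simpa [Polynomial.finsetSum_coeff, Polynomial.coeff_monomial, hm] using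
    congrArg (fun q => q.coeff m) hq

theorem eq_neg_one_pow_mul_choose_sq {l : ℕ} {a : ℕ → ℝ}
    (h : ∀ m < l, a (m + 1) * (m + 1 : ℝ) ^ 2 + a m * ((l - m : ℕ) : ℝ) ^ 2 = 0) :
    ∀ k ≤ l, a k = a 0 * (-1) ^ k * (Nat.choose l k : ℝ) ^ 2
  | 0, _ => by simp
  | m + 1, hm => by
    have ih := eq_neg_one_pow_mul_choose_sq h m (by omega)
    have hr := h m hm
    have hc : (Nat.choose l (m + 1) : ℝ) * (m + 1) = Nat.choose l m * ((l - m : ℕ) : ℝ) := by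
      exact_mod_cast Nat.choose_succ_right_eq l m
    have hpos : ((m : ℝ) + 1) ^ 2 ≠ 0 := by positivity
    refine mul_right_cancel₀ hpos ?_
    rw [ih] at hr
    linear_combination hr + a 0 * (-1) ^ m *
      (Nat.choose l (m + 1) * (m + 1) + Nat.choose l m * ((l - m : ℕ) : ℝ)) * hc

theorem sum_range_choose_sq_cast (l : ℕ) :
    ∑ k ∈ Finset.range (l + 1), (Nat.choose l k : ℝ) ^ 2 = Nat.choose (2 * l) l := by
  exact_mod_cast Nat.sum_range_choose_sq l

/-- Uniqueness part of the characterization (1.28a)–(1.28b): any homogeneous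
polynomial P(α,β) = Σ_{k=0}^{l} a_k α^k β^{l−k} of degree l satisfying the PDE
α·∂²P/∂α² + β·∂²P/∂β² + ∂P/∂α + ∂P/∂β = 0 and P(1,−1) = 1 equals 𝒟_l. -/
theorem Dl_unique (l : ℕ) (a : ℕ → ℝ) (P : ℝ → ℝ → ℝ)
    (hP : ∀ α β : ℝ,
      P α β = ∑ k ∈ Finset.range (l + 1), a k * α ^ k * β ^ (l - k))
    (hPDE : ∀ α β : ℝ,
      α * deriv (deriv fun x => P x β) α +
        β * deriv (deriv fun y => P α y) β +
        deriv (fun x => P x β) α + deriv (fun y => P α y) β = 0)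
    (hnorm : P 1 (-1) = 1) :
    ∀ α β : ℝ, P α β = Dl l α β := by
  have hrec : ∀ m < l, a (m + 1) * (m + 1 : ℝ) ^ 2 + a m * ((l - m : ℕ) : ℝ) ^ 2 = 0 := by
    intro m hm
    refine eq_zero_of_sum_mul_pow_eq_zero (l := l)
      (c := fun m => a (m + 1) * (m + 1 : ℝ) ^ 2 + a m * ((l - m : ℕ) : ℝ) ^ 2)
      (fun x => ?_) hm
    have hx : (fun x => P x 1) = fun x => ∑ k ∈ Finset.range (l + 1), a k * x ^ k := by
      funext x
      simp [hP]
    have hy : (fun y => P x y) =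
        fun y => ∑ k ∈ Finset.range (l + 1), (a k * x ^ k) * y ^ (l - k) := funext (hP x)
    have e₁ := mul_deriv_deriv_add_deriv_sum_mul_pow (Finset.range (l + 1)) a (fun k => k) x
    have e₂ := mul_deriv_deriv_add_deriv_sum_mul_pow (Finset.range (l + 1))
      (fun k => a k * x ^ k) (fun k => l - k) 1
    have h := hPDE x 1
    rw [hx, hy] at h
    rw [Finset.sum_range_succ'] at e₁
    rw [Finset.sum_range_succ (n := l) (f := fun k =>
      a k * x ^ k * ((l - k : ℕ) : ℝ) ^ 2 * 1 ^ (l - k - 1))] at e₂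
    simp only [Nat.sub_self, Nat.cast_zero, Nat.add_sub_cancel, one_pow, mul_one, ne_eq,
      OfNat.ofNat_ne_zero, not_false_eq_true, zero_pow, mul_zero, zero_mul, add_zero,
      Nat.cast_add, Nat.cast_one] at e₁ e₂
    simp only [add_mul, Finset.sum_add_distrib]
    have e₃ : ∑ k ∈ Finset.range l, a k * ((l - k : ℕ) : ℝ) ^ 2 * x ^ k =
        ∑ k ∈ Finset.range l, a k * x ^ k * ((l - k : ℕ) : ℝ) ^ 2 :=
      Finset.sum_congr rfl fun k _ => by ring
    linear_combination h - e₁ - e₂ + e₃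
  have ha := eq_neg_one_pow_mul_choose_sq hrec
  have hform : ∀ α β : ℝ, P α β = a 0 * (-1) ^ l *
      ∑ k ∈ Finset.range (l + 1), (Nat.choose l k : ℝ) ^ 2 * α ^ k * (-β) ^ (l - k) := by
    intro α β
    rw [hP, Finset.mul_sum]
    refine Finset.sum_congr rfl fun k hk => ?_
    obtain ⟨j, rfl⟩ := Nat.exists_eq_add_of_le (Finset.mem_range_succ_iff.mp hk)
    have hsq : ((-1 : ℝ) ^ j) * (-1) ^ j = 1 := by rw [← mul_pow]; simp
    rw [ha k (Nat.le_add_right k j), Nat.add_sub_cancel_left, neg_pow β, pow_add]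
    linear_combination
      -(a 0 * (-1) ^ k * (Nat.choose (k + j) k : ℝ) ^ 2 * α ^ k * β ^ j) * hsq
  rw [hform] at hnorm
  simp only [neg_neg, one_pow, mul_one, sum_range_choose_sq_cast] at hnorm
  intro α β
  rw [hform, Dl, eq_inv_of_mul_eq_one_left hnorm]
end
end

section
/- Let θ : ℤ → ℝ be given by θ(i) = 1 for i > 0, θ(0) = 1/2, θ(i) = 0 for i < 0, and for single-diagonal matrices X, Y : ℤ × ℤ → ℂ define ω(X,Y) = Σ_{i,j ∈ ℤ} (θ(j) − θ(i)) X(i,j) Y(j,i) (a finite sum). Let l be a natural number, n ∈ ℤ, A(i,j) = j^l if i = j + n and 0 otherwise, and Λ_m(i,j) = 1 if i = j + m and 0 otherwise. Then for all m₀, m₁, …, m_l ∈ ℤ: ω( Λ_{m₀}, ad Λ_{m₁}(⋯ ad Λ_{m_l}(A) ⋯) ) = (−1)^{l+1} · l! · m₀ m₁ ⋯ m_l if m₀ + m₁ + ⋯ + m_l + n = 0, and = 0 otherwise. (The central-value statement of Proposition 2.1: the (l+1)-fold commutator of current modes with a mode of V^l is the explicit multiple l!·Π m_ν of the central element.) 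-/
open scoped BigOperators

noncomputable section

/-- θ(i) = 1 for i > 0, θ(0) = 1/2, θ(i) = 0 for i < 0. -/
def theta : ℤ → ℝ := fun i => if 0 < i then 1 else if i = 0 then 1 / 2 else 0

/-- Matrix product of two infinite matrices (entrywise a finite sum for
single-diagonal matrices). -/
def mmul (X Y : ℤ × ℤ → ℂ) : ℤ × ℤ → ℂ :=
  fun p => ∑ᶠ j : ℤ, X (p.1, j) * Y (j, p.2)

/-- Adjoint action ad X(Y) = XY − YX. -/
def adM (X Y : ℤ × ℤ → ℂ) : ℤ × ℤ → ℂ :=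
  fun p => mmul X Y p - mmul Y X p

/-- The shift matrix Λ_m with Λ_m(i,j) = 1 if i = j + m and 0 otherwise. -/
def Lam (m : ℤ) : ℤ × ℤ → ℂ := fun p => if p.1 = p.2 + m then 1 else 0

/-- ω(X,Y) = Σ_{i,j} (θ(j) − θ(i)) X(i,j) Y(j,i) (a finite sum). -/
def omegaCocycle (X Y : ℤ × ℤ → ℂ) : ℂ :=
  ∑ᶠ i : ℤ, ∑ᶠ j : ℤ, ((theta j - theta i : ℝ) : ℂ) * X (i, j) * Y (j, i)

open Polynomial in
/-- The matrix supported on the diagonal `i = j + d` with entries `q j`. -/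
def diagMat (d : ℤ) (q : ℂ[X]) : ℤ × ℤ → ℂ :=
  fun p => if p.1 = p.2 + d then q.eval (p.2 : ℂ) else 0

lemma mmul_Lam_left (m : ℤ) (Y : ℤ × ℤ → ℂ) (p : ℤ × ℤ) :
    mmul (Lam m) Y p = Y (p.1 - m, p.2) := by
  rw [mmul, finsum_eq_single _ (p.1 - m)]
  · simp [Lam]
  · intro j hj
    have : p.1 ≠ j + m := by omega
    simp [Lam, this]

lemma mmul_Lam_right (m : ℤ) (Y : ℤ × ℤ → ℂ) (p : ℤ × ℤ) :
    mmul Y (Lam m) p = Y (p.1, p.2 + m) := by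
  rw [mmul, finsum_eq_single _ (p.2 + m)]
  · simp [Lam]
  · intro j hj
    simp [Lam, hj]

lemma adM_Lam_diagMat (m d : ℤ) (q : Polynomial ℂ) :
    adM (Lam m) (diagMat d q) = diagMat (d + m) (q - Polynomial.taylor (m : ℂ) q) := by
  funext p
  have h₁ : p.1 - m = p.2 + d ↔ p.1 = p.2 + (d + m) := by omega
  have h₂ : p.1 = p.2 + m + d ↔ p.1 = p.2 + (d + m) := by omega
  simp only [adM, mmul_Lam_left, mmul_Lam_right, diagMat, h₁, h₂]
  split_ifs <;> simp [Polynomial.taylor_eval]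

lemma coeff_taylor_of_natDegree_le_succ {R : Type*} [CommRing R] (r : R) {q : Polynomial R}
    {k : ℕ} (hq : q.natDegree ≤ k + 1) :
    (Polynomial.taylor r q).coeff k = q.coeff k + (k + 1) * q.coeff (k + 1) * r := by
  have h : (Polynomial.hasseDeriv k q).natDegree < 2 := by
    have := Polynomial.natDegree_hasseDeriv_le q k
    omega
  rw [Polynomial.taylor_coeff, Polynomial.eval_eq_sum_range' h]
  simp [Finset.sum_range_succ, Polynomial.hasseDeriv_coeff, add_comm 1 k]

lemma natDegree_sub_taylor_le {R : Type*} [CommRing R] (r : R) {q : Polynomial R} {k : ℕ}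
    (hq : q.natDegree ≤ k + 1) : (q - Polynomial.taylor r q).natDegree ≤ k := by
  have h : (q - Polynomial.taylor r q).natDegree ≤ k + 1 :=
    (Polynomial.natDegree_sub_le _ _).trans (by simpa using hq)
  refine Polynomial.natDegree_le_pred (n := k + 1) h ?_
  have := coeff_taylor_of_natDegree_le_succ r (hq.trans (Nat.le_succ (k + 1)))
  rw [Polynomial.coeff_sub, this, Polynomial.coeff_eq_zero_of_natDegree_lt (n := k + 1 + 1)
    (by omega)]
  ring

lemma exists_foldr_adM_eq_diagMat (n : ℤ) (L : List ℤ) (k : ℕ) {p : Polynomial ℂ}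
    (hp : p.natDegree ≤ L.length + k) :
    ∃ q : Polynomial ℂ, q.natDegree ≤ k ∧
      (k.factorial : ℂ) * q.coeff k =
        (-1) ^ L.length * ((L.length + k).factorial : ℂ) * ((L.prod : ℤ) : ℂ) *
          p.coeff (L.length + k) ∧
      L.foldr (fun mi B => adM (Lam mi) B) (diagMat n p) = diagMat (L.sum + n) q := by
  induction L generalizing k with
  | nil => exact ⟨p, by simpa using hp, by simp, by simp⟩
  | cons a L ih =>
    have hlen : (a :: L).length + k = L.length + (k + 1) := by
      rw [List.length_cons]
      omega
    obtain ⟨q, hq, hcoeff, hfold⟩ := ih (k + 1) (hlen ▸ hp)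
    refine ⟨q - Polynomial.taylor (a : ℂ) q, natDegree_sub_taylor_le _ hq, ?_, ?_⟩
    · rw [hlen, Polynomial.coeff_sub, coeff_taylor_of_natDegree_le_succ _ hq]
      rw [Nat.factorial_succ] at hcoeff
      push_cast [List.prod_cons, List.length_cons, pow_succ] at hcoeff ⊢
      linear_combination (-(a : ℂ)) * hcoeff
    · rw [List.foldr_cons, hfold, adM_Lam_diagMat, List.sum_cons]
      congr 1
      ring

lemma support_theta_succ_sub_subset (m : ℤ) :
    (Function.support fun i => theta (i + (m + 1)) - theta (i + m)) ⊆
      (({-m, -m - 1} : Finset ℤ) : Set ℤ) := by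
  intro i hi
  by_contra h
  simp only [Finset.coe_insert, Finset.coe_singleton, Set.mem_insert_iff,
    Set.mem_singleton_iff, not_or] at h
  refine hi ?_
  have h₁ : 0 < i + (m + 1) ↔ 0 < i + m := by omega
  have h₂ : i + (m + 1) ≠ 0 := by omega
  have h₃ : i + m ≠ 0 := by omega
  simp [theta, h₁, h₂, h₃]

lemma finsum_theta_succ_sub (m : ℤ) :
    ∑ᶠ i : ℤ, (theta (i + (m + 1)) - theta (i + m)) = 1 := by
  have h : -m ≠ -m - 1 := by omega
  rw [finsum_eq_sum_of_support_subset _ (support_theta_succ_sub_subset m), Finset.sum_pair h,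
    show -m + (m + 1) = 1 by ring, show -m + m = 0 by ring, show -m - 1 + (m + 1) = 0 by ring,
    show -m - 1 + m = -1 by ring]
  norm_num [theta]

lemma finite_support_and_finsum_theta_add_sub (m : ℤ) :
    (Function.support fun i => theta (i + m) - theta i).Finite ∧
      ∑ᶠ i : ℤ, (theta (i + m) - theta i) = m := by
  have hfin (m : ℤ) : (Function.support fun i => theta (i + (m + 1)) - theta (i + m)).Finite :=
    (Finset.finite_toSet _).subset (support_theta_succ_sub_subset m)
  induction m using Int.induction_on with
  | zero => simp
  | succ k ih =>
    have h : (fun i : ℤ => theta (i + (k + 1)) - theta i) =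
        fun i => (theta (i + k) - theta i) + (theta (i + (k + 1)) - theta (i + k)) := by
      funext i
      ring
    rw [h, finsum_add_distrib ih.1 (hfin k), ih.2, finsum_theta_succ_sub]
    exact ⟨(ih.1.union (hfin k)).subset (Function.support_add _ _), by push_cast; ring⟩
  | pred k ih =>
    have h : (fun i : ℤ => theta (i + (-k - 1)) - theta i) =
        fun i => (theta (i + -k) - theta i) -
          (theta (i + ((-k - 1) + 1)) - theta (i + (-k - 1))) := by
      funext i
      rw [sub_add_cancel]
      ring
    rw [h, finsum_sub_distrib ih.1 (hfin _), ih.2, finsum_theta_succ_sub]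
    exact ⟨(ih.1.union (hfin _)).subset (Function.support_sub _ _), by push_cast; ring⟩

lemma omegaCocycle_Lam_diagMat_C (m d : ℤ) (c : ℂ) :
    omegaCocycle (Lam m) (diagMat d (Polynomial.C c)) =
      if m + d = 0 then -(m : ℂ) * c else 0 := by
  have hinner (i : ℤ) :
      ∑ᶠ j : ℤ, ((theta j - theta i : ℝ) : ℂ) * Lam m (i, j) * diagMat d (Polynomial.C c) (j, i) =
        if m + d = 0 then ((theta (i + -m) - theta i : ℝ) : ℂ) * c else 0 := by
    rw [finsum_eq_single _ (i + -m)]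
    · have h : i + -m = i + d ↔ m + d = 0 := by omega
      simp only [Lam, diagMat, h]
      simp
    · intro j hj
      have : i ≠ j + m := by omega
      simp [Lam, this]
  simp only [omegaCocycle, hinner]
  split_ifs
  · obtain ⟨hfin, hsum⟩ := finite_support_and_finsum_theta_add_sub (-m)
    rw [← finsum_mul]
    congr 1
    have := (Complex.ofRealHom : ℝ →+* ℂ).toAddMonoidHom.map_finsum hfin
    rw [hsum] at this
    simpa using this.symm
  · simp

/-- The central-value statement of Proposition 2.1: with A(i,j) = j^l on the
diagonal i = j + n and zero elsewhere,
ω(Λ_{m₀}, ad Λ_{m₁}(⋯ ad Λ_{m_l}(A)⋯)) = (−1)^{l+1} l! m₀ m₁ ⋯ m_l if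
m₀ + m₁ + ⋯ + m_l + n = 0, and 0 otherwise. -/
theorem central_value_of_iterated_commutator (l : ℕ) (n : ℤ) (m₀ : ℤ)
    (m : Fin l → ℤ) :
    omegaCocycle (Lam m₀)
        ((List.ofFn m).foldr (fun mi B => adM (Lam mi) B)
          (fun q : ℤ × ℤ => if q.1 = q.2 + n then (q.2 : ℂ) ^ l else 0)) =
      if m₀ + (∑ i, m i) + n = 0 then
        (-1 : ℂ) ^ (l + 1) * (Nat.factorial l : ℂ) * (m₀ : ℂ) *
          ∏ i, (m i : ℂ)
      else 0 := by
  have hA : (fun q : ℤ × ℤ => if q.1 = q.2 + n then (q.2 : ℂ) ^ l else 0) =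
      diagMat n (Polynomial.X ^ l) := by
    funext q
    simp [diagMat]
  obtain ⟨q, hq, hcoeff, hfold⟩ := exists_foldr_adM_eq_diagMat n (List.ofFn m) 0
    (p := Polynomial.X ^ l) (by simp)
  rw [hA, hfold, Polynomial.eq_C_of_natDegree_le_zero hq, omegaCocycle_Lam_diagMat_C,
    List.sum_ofFn, ← add_assoc]
  simp only [Nat.factorial_zero, Nat.cast_one, one_mul, List.length_ofFn, add_zero,
    List.prod_ofFn, Int.cast_prod, Polynomial.coeff_X_pow_self, mul_one] at hcoeff
  rw [hcoeff]
  congr 1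
  ring
end
end

section
/- For a natural number l define v_l : ℝ → ℝ by v₀(r) = r and, for l ≥ 1, v_l(r) = ((l−1)!·l!/(2l)!) · Σ_{k=0}^{l−1} C(l,k)·C(l,k+1) · r · Π_{i=0}^{l−1} (r − k + i). Then for every natural number c, every tuple r = (r₁,…,r_c) of real numbers, and every real η with 0 < η < 1: Σ_{i=1}^{c} ( (1−η)^{−r_i} − 1 ) = Σ_{l=0}^{∞} ( V_l(r)/l! ) · η^{l+1} · ₂F₁(l+1, l+1; 2l+2; η), where V_l(r) = Σ_{i=1}^{c} v_l(r_i), and the series over l converges. (Identity (2.8) with η = 1 − w/z, expanding the ground-state expectation value of the bilocal field V(z,w) in the quasiprimary basis.) -/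
noncomputable section

/-- Rising factorial (Pochhammer symbol) (x)_n = x(x+1)⋯(x+n−1). -/
def risingFac (x : ℝ) (n : ℕ) : ℝ := ∏ i ∈ Finset.range n, (x + i)

/-- The Gauss hypergeometric function ₂F₁(a,b;c;η), defined by its power
series (convergent for |η| < 1). -/
def hyperF (a b c η : ℝ) : ℝ :=
  ∑' n : ℕ, risingFac a n * risingFac b n /
    (risingFac c n * (Nat.factorial n : ℝ)) * η ^ n

/-- The polynomial function v_l : v₀(r) = r and, for l ≥ 1,
v_l(r) = ((l−1)!·l!/(2l)!) Σ_{k=0}^{l−1} C(l,k) C(l,k+1) r Π_{i=0}^{l−1}(r−k+i). -/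
def vl : ℕ → ℝ → ℝ
  | 0, r => r
  | (m + 1), r =>
      ((Nat.factorial m : ℝ) * (Nat.factorial (m + 1) : ℝ) /
          (Nat.factorial (2 * (m + 1)) : ℝ)) *
        ∑ k ∈ Finset.range (m + 1),
          (Nat.choose (m + 1) k : ℝ) * (Nat.choose (m + 1) (k + 1) : ℝ) * r *
            ∏ i ∈ Finset.range (m + 1), (r - (k : ℝ) + (i : ℝ))

/-- The `k`-th summand of the sum over binomial products in `vl`, without the factor `r`. -/
def narayanaTerm (r : ℝ) (l k : ℕ) : ℝ :=
  (l.choose k : ℝ) * (l.choose (k + 1) : ℝ) * risingFac (r - k) l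

lemma risingFac_succ (x : ℝ) (n : ℕ) : risingFac x (n + 1) = risingFac x n * (x + n) :=
  Finset.prod_range_succ _ _

lemma risingFac_succ' (x : ℝ) (n : ℕ) : risingFac x (n + 1) = x * risingFac (x + 1) n := by
  simp only [risingFac]
  rw [Finset.prod_range_succ', mul_comm]
  congr 1
  · simp
  · refine Finset.prod_congr rfl fun i _ => ?_
    push_cast
    ring

lemma risingFac_natCast_add_one (a j : ℕ) :
    risingFac ((a : ℝ) + 1) j = ((a + j).factorial : ℝ) / a.factorial := by
  have ha : (a.factorial : ℝ) ≠ 0 := by positivity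
  induction j with
  | zero => simp [risingFac, ha]
  | succ j ih =>
    rw [risingFac_succ, ih, ← add_assoc, Nat.factorial_succ]
    push_cast
    field_simp
    ring

lemma vl_succ (m : ℕ) (r : ℝ) :
    vl (m + 1) r = (m.factorial : ℝ) * (m + 1).factorial / (2 * (m + 1)).factorial *
      (r * ∑ k ∈ Finset.range (m + 1), narayanaTerm r (m + 1) k) := by
  simp only [vl, narayanaTerm, risingFac, Finset.mul_sum]
  refine Finset.sum_congr rfl fun k _ => ?_
  ring

lemma cast_choose_succ_right (n k : ℕ) :
    (n.choose (k + 1) : ℝ) = n.choose k * (n - k) / (k + 1) := by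
  rw [eq_div_iff (by positivity)]
  rcases le_or_gt k n with h | h
  · have := Nat.choose_succ_right_eq n k
    rw [← Nat.cast_sub h]
    exact_mod_cast this
  · simp [Nat.choose_eq_zero_of_lt h, Nat.choose_eq_zero_of_lt (Nat.lt_succ_of_lt h)]

/-- Antidifference produced by Zeilberger's algorithm for the three-term recurrence of
`∑ k, narayanaTerm r l k`. -/
def narayanaCert (r : ℝ) (m : ℕ) : ℕ → ℝ
  | 0 => 0
  | k + 1 => (m + 1) * (-(3 * m + 5) * r - (m + 1) * (2 * m + 3) + (2 * r + 3 * m + 4) * (k + 1)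
      - (k + 1) ^ 2) * risingFac (r - (k + 1)) (m + 1) * (m + 2).choose (k + 1) * m.choose k

lemma narayanaCert_sub (r : ℝ) (m k : ℕ) (hk : k ≤ m + 1) :
    narayanaCert r m (k + 1) - narayanaCert r m k =
      (m + 3) * (m + 1) * narayanaTerm r (m + 2) k
        - 2 * r * (m + 2) * (2 * m + 3) * narayanaTerm r (m + 1) k
        - (m + 1) ^ 3 * (m + 2) * narayanaTerm r m k := by
  have e1 : risingFac (r - (k + 1)) (m + 1) = (r - (k + 1)) * risingFac (r - k) m := by
    rw [risingFac_succ']; congr 2; ring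
  have e2 : risingFac (r - k) (m + 1) = risingFac (r - k) m * (r - k + m) := risingFac_succ _ _
  have e3 : risingFac (r - k) (m + 2) = risingFac (r - k) m * (r - k + m) * (r - k + m + 1) := by
    rw [risingFac_succ, e2]; push_cast; ring
  simp only [narayanaTerm, e2, e3]
  cases k with
  | zero =>
    simp only [narayanaCert, Nat.choose_zero_right, zero_add, Nat.choose_one_right]
    push_cast at e1 ⊢
    rw [zero_add] at e1
    rw [zero_add, e1]
    ring
  | succ j =>
    have hj : (0 : ℝ) < m + 1 - j := by
      have : (j : ℝ) ≤ m := by exact_mod_cast Nat.le_of_succ_le_succ hk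
      linarith
    have c1 := cast_choose_succ_right m j
    have c2 := cast_choose_succ_right m (j + 1)
    have c0 : ((m + 1).choose j : ℝ) = (m + 1) * m.choose j / (m + 1 - j) := by
      have h1 := cast_choose_succ_right (m + 1) j
      have h2 : ((m + 1).choose (j + 1) : ℝ) * (j + 1) = (m + 1) * m.choose j := by
        exact_mod_cast (Nat.add_one_mul_choose_eq m j).symm
      push_cast at h1
      rw [h1] at h2
      field_simp at h2 ⊢
      linarith
    simp only [narayanaCert, Nat.choose_succ_succ', e1]
    push_cast at c1 c2 e2 ⊢
    rw [e2, c0, c2, c1]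
    field_simp
    ring

lemma narayanaTerm_sum_rec (r : ℝ) (m : ℕ) :
    (m + 3) * (m + 1) * ∑ k ∈ Finset.range (m + 2), narayanaTerm r (m + 2) k
      = 2 * r * (m + 2) * (2 * m + 3) * ∑ k ∈ Finset.range (m + 1), narayanaTerm r (m + 1) k
        + (m + 1) ^ 3 * (m + 2) * ∑ k ∈ Finset.range m, narayanaTerm r m k := by
  have h := Finset.sum_range_sub (narayanaCert r m) (m + 2)
  rw [Finset.sum_congr rfl fun k hk => narayanaCert_sub r m k
    (by have := Finset.mem_range.mp hk; omega)] at h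
  simp only [Finset.sum_sub_distrib, ← Finset.mul_sum] at h
  rw [Finset.sum_range_succ (narayanaTerm r (m + 1)),
    Finset.sum_range_succ (narayanaTerm r m) (m + 1),
    Finset.sum_range_succ (narayanaTerm r m) m] at h
  simp [narayanaCert, narayanaTerm] at h
  simp only [narayanaTerm]
  linarith

/-- Coefficient of the three-term recurrence satisfied by `vl l r / l!`. -/
def blockBeta (l : ℕ) : ℝ := l * (l + 1) ^ 2 / (4 * (2 * l + 1) * (2 * l + 3))

lemma blockBeta_nonneg (l : ℕ) : 0 ≤ blockBeta l := by
  unfold blockBeta; positivity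

lemma vl_div_factorial_rec (r : ℝ) (l : ℕ) :
    ((l : ℝ) + 3) * (vl (l + 2) r / (l + 2).factorial) =
      r * (vl (l + 1) r / (l + 1).factorial) + blockBeta l * (vl l r / l.factorial) := by
  have h := narayanaTerm_sum_rec r l
  cases l with
  | zero =>
    simp [vl, blockBeta, Finset.prod_range_succ, Finset.sum_range_succ, Nat.factorial]
    ring
  | succ p =>
    rw [vl_succ, vl_succ, vl_succ]
    simp only [blockBeta]
    set s2 := ∑ k ∈ Finset.range (p + 1 + 2), narayanaTerm r (p + 1 + 2) k
    set s1 := ∑ k ∈ Finset.range (p + 1 + 1), narayanaTerm r (p + 1 + 1) k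
    set s0 := ∑ k ∈ Finset.range (p + 1), narayanaTerm r (p + 1) k
    have f0 : (p.factorial : ℝ) ≠ 0 := by positivity
    have f1 : ((2 * (p + 1)).factorial : ℝ) ≠ 0 := by positivity
    rw [show 2 * (p + 1 + 1 + 1) = 2 * (p + 1) + 1 + 1 + 1 + 1 by ring,
      show 2 * (p + 1 + 1) = 2 * (p + 1) + 1 + 1 by ring]
    simp only [Nat.factorial_succ (2 * (p + 1)), Nat.factorial_succ (2 * (p + 1) + 1),
      Nat.factorial_succ (2 * (p + 1) + 1 + 1), Nat.factorial_succ (2 * (p + 1) + 1 + 1 + 1),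
      Nat.factorial_succ p, Nat.factorial_succ (p + 1), Nat.factorial_succ (p + 1 + 1)]
    push_cast at h ⊢
    have hs : s2 = (2 * r * (p + 1 + 2) * (2 * (p + 1) + 3) * s1
        + (p + 1 + 1) ^ 3 * (p + 1 + 2) * s0) / ((p + 1 + 3) * (p + 1 + 1)) := by
      field_simp
      linarith
    rw [hs]
    generalize ((2 * (p + 1)).factorial : ℝ) = F at *
    field_simp
    ring

lemma vl_div_factorial_zero (r : ℝ) : vl 0 r / (Nat.factorial 0 : ℝ) = r := by
  simp [vl]

lemma vl_div_factorial_one (r : ℝ) : vl 1 r / (Nat.factorial 1 : ℝ) = r ^ 2 / 2 := by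
  simp [vl]
  ring

lemma vl_div_factorial_nonneg {r : ℝ} (hr : 0 ≤ r) (l : ℕ) : 0 ≤ vl l r / l.factorial := by
  induction l using Nat.twoStepInduction with
  | zero => rw [vl_div_factorial_zero]; exact hr
  | one => rw [vl_div_factorial_one]; positivity
  | more l h0 h1 =>
    have h := vl_div_factorial_rec r l
    have := blockBeta_nonneg l
    have h2 : 0 ≤ ((l : ℝ) + 3) * (vl (l + 2) r / (l + 2).factorial) := by
      rw [h]; positivity
    exact nonneg_of_mul_nonneg_right h2 (by positivity)

lemma abs_vl_div_factorial_le (r : ℝ) (l : ℕ) :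
    |vl l r / l.factorial| ≤ vl l |r| / l.factorial := by
  induction l using Nat.twoStepInduction with
  | zero => rw [vl_div_factorial_zero, vl_div_factorial_zero]
  | one => rw [vl_div_factorial_one, vl_div_factorial_one, sq_abs, abs_of_nonneg (by positivity)]
  | more l h0 h1 =>
    have hb := blockBeta_nonneg l
    have hl : (0 : ℝ) < l + 3 := by positivity
    refine le_of_mul_le_mul_left ?_ hl
    nth_rewrite 1 [← abs_of_pos hl]
    rw [vl_div_factorial_rec |r| l, ← abs_mul, vl_div_factorial_rec r l]
    refine (abs_add_le _ _).trans ?_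
    rw [abs_mul, abs_mul, abs_of_nonneg hb]
    gcongr

/-- Coefficient of `η ^ (n + 1)` in `η ^ (l + 1) * ₂F₁(l + 1, l + 1; 2 l + 2; η)`. -/
def blockCoeff (l n : ℕ) : ℝ :=
  (2 * l + 1).factorial * n.factorial * n.choose l / (l.factorial * (n + l + 1).factorial)

lemma blockCoeff_nonneg (l n : ℕ) : 0 ≤ blockCoeff l n := by
  unfold blockCoeff; positivity

lemma blockCoeff_eq_zero {l n : ℕ} (h : n < l) : blockCoeff l n = 0 := by
  simp [blockCoeff, Nat.choose_eq_zero_of_lt h]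

lemma blockCoeff_zero (n : ℕ) : blockCoeff 0 n = 1 / (n + 1) := by
  have : (n.factorial : ℝ) ≠ 0 := by positivity
  simp [blockCoeff, Nat.factorial_succ]
  field_simp

lemma blockCoeff_add (l j : ℕ) :
    blockCoeff l (j + l) = risingFac ((l : ℝ) + 1) j * risingFac ((l : ℝ) + 1) j /
      (risingFac (2 * (l : ℝ) + 2) j * j.factorial) := by
  have e : 2 * (l : ℝ) + 2 = ((2 * l + 1 : ℕ) : ℝ) + 1 := by push_cast; ring
  rw [e, risingFac_natCast_add_one, risingFac_natCast_add_one, blockCoeff, add_comm j l,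
    Nat.cast_add_choose, show 2 * l + 1 + j = l + j + l + 1 by ring]
  have : ((l + j).factorial : ℝ) ≠ 0 := by positivity
  field_simp

lemma blockCoeff_rec (l n : ℕ) :
    ((n : ℝ) + 2) * blockCoeff (l + 1) (n + 1) - (n + 1) * blockCoeff (l + 1) n =
      (l + 2) * blockCoeff l n - blockBeta (l + 1) * blockCoeff (l + 2) n := by
  have c1 := cast_choose_succ_right n l
  have c2 := cast_choose_succ_right n (l + 1)
  have f0 : (l.factorial : ℝ) ≠ 0 := by positivity
  have f1 : (n.factorial : ℝ) ≠ 0 := by positivity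
  have f2 : ((2 * l + 1).factorial : ℝ) ≠ 0 := by positivity
  have f3 : ((n + l + 1).factorial : ℝ) ≠ 0 := by positivity
  simp only [blockCoeff, blockBeta, Nat.choose_succ_succ',
    show 2 * (l + 2) + 1 = 2 * l + 1 + 1 + 1 + 1 + 1 by ring,
    show 2 * (l + 1) + 1 = 2 * l + 1 + 1 + 1 by ring,
    show n + 1 + (l + 1) + 1 = n + l + 1 + 1 + 1 by ring,
    show n + (l + 1) + 1 = n + l + 1 + 1 by ring,
    show n + (l + 2) + 1 = n + l + 1 + 1 + 1 by ring,
    Nat.factorial_succ (2 * l + 1), Nat.factorial_succ (2 * l + 1 + 1),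
    Nat.factorial_succ (2 * l + 1 + 1 + 1), Nat.factorial_succ (2 * l + 1 + 1 + 1 + 1),
    Nat.factorial_succ (n + l + 1), Nat.factorial_succ (n + l + 1 + 1),
    Nat.factorial_succ l, Nat.factorial_succ (l + 1), Nat.factorial_succ n]
  push_cast at c1 c2 ⊢
  rw [c2, c1]
  generalize ((2 * l + 1).factorial : ℝ) = A at *
  generalize ((n + l + 1).factorial : ℝ) = B at *
  field_simp
  ring

lemma sum_vl_mul_blockCoeff_rec (r : ℝ) (n N : ℕ) :
    ∑ l ∈ Finset.range (N + 1), vl l r / l.factorial *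
        ((n + 2) * blockCoeff l (n + 1) - (n + 1) * blockCoeff l n - r * blockCoeff l n) =
      -(vl N r / N.factorial * blockBeta N * blockCoeff (N + 1) n)
        - (N + 2) * (vl (N + 1) r / (N + 1).factorial) * blockCoeff N n := by
  induction N with
  | zero =>
    rw [Finset.sum_range_one, vl_div_factorial_zero, zero_add, vl_div_factorial_one]
    simp only [blockCoeff_zero, blockBeta]
    push_cast
    field_simp
    ring
  | succ N ih =>
    rw [Finset.sum_range_succ, ih]
    have h1 := vl_div_factorial_rec r N
    have h2 := blockCoeff_rec N n
    push_cast
    linear_combination (vl (N + 1) r / (N + 1).factorial) * h2 + blockCoeff (N + 1) n * h1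

lemma sum_vl_mul_blockCoeff (r : ℝ) (n : ℕ) :
    ∑ l ∈ Finset.range (n + 1), vl l r / l.factorial * blockCoeff l n =
      risingFac r (n + 1) / (n + 1).factorial := by
  induction n with
  | zero => simp [risingFac, blockCoeff_zero, vl]
  | succ n ih =>
    have h := sum_vl_mul_blockCoeff_rec r n (n + 1)
    rw [blockCoeff_eq_zero (by omega : n < n + 1),
      blockCoeff_eq_zero (by omega : n < n + 1 + 1)] at h
    have e : ∑ l ∈ Finset.range (n + 1 + 1), vl l r / l.factorial * blockCoeff l n =
        risingFac r (n + 1) / (n + 1).factorial := by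
      rw [Finset.sum_range_succ, blockCoeff_eq_zero (by omega : n < n + 1), mul_zero, add_zero, ih]
    have h' : ((n : ℝ) + 2) * ∑ l ∈ Finset.range (n + 1 + 1),
          vl l r / l.factorial * blockCoeff l (n + 1)
        - (n + 1 + r) * ∑ l ∈ Finset.range (n + 1 + 1), vl l r / l.factorial * blockCoeff l n
        = 0 := by
      rw [Finset.mul_sum, Finset.mul_sum, ← Finset.sum_sub_distrib]
      rw [mul_zero, mul_zero, neg_zero, sub_zero] at h
      rw [← h]
      refine Finset.sum_congr rfl fun l _ => ?_
      ring
    rw [e] at h'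
    rw [risingFac_succ, Nat.factorial_succ (n + 1)]
    have hf : ((n + 1).factorial : ℝ) ≠ 0 := by positivity
    push_cast
    field_simp at h' ⊢
    linarith

lemma hasSum_one_sub_rpow_neg (r : ℝ) {η : ℝ} (h0 : 0 < η) (h1 : η < 1) :
    HasSum (fun n : ℕ => risingFac r (n + 1) / (n + 1).factorial * η ^ (n + 1))
      ((1 - η) ^ (-r) - 1) := by
  have hη : η ∈ Metric.eball (0 : ℝ) 1 := by
    simp [Metric.mem_eball, edist_dist, abs_of_pos h0, h1]
  have h := (Real.one_div_one_sub_rpow_hasFPowerSeriesOnBall_zero r).hasSum hη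
  have hc (n : ℕ) : Ring.choose (r + n - 1) n = risingFac r n / n.factorial := by
    have h := Ring.factorial_nsmul_multichoose_eq_ascPochhammer r n
    rw [Ring.choose, show r + n - 1 - n + 1 = r by ring, eq_div_iff (by positivity), mul_comm,
      ← nsmul_eq_mul, h]
    clear h
    induction n with
    | zero => simp [risingFac]
    | succ n ih =>
      simp only [Polynomial.ascPochhammer_smeval_eq_eval] at ih ⊢
      rw [ascPochhammer_succ_eval, risingFac_succ, ih]
  simp only [zero_add, FormalMultilinearSeries.ofScalars_apply_eq, hc, smul_eq_mul] at h
  rw [Real.rpow_neg (by linarith), ← one_div]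
  simpa [risingFac] using (hasSum_nat_add_iff' 1).mpr h

lemma hasSum_vl_block (r : ℝ) {η : ℝ} (h0 : 0 < η) (h1 : η < 1) :
    HasSum (fun l : ℕ => vl l r / l.factorial * η ^ (l + 1) *
        hyperF ((l : ℝ) + 1) ((l : ℝ) + 1) (2 * (l : ℝ) + 2) η)
      ((1 - η) ^ (-r) - 1) := by
  have fiber (r : ℝ) (n : ℕ) :
      HasSum (fun l : ℕ => vl l r / l.factorial * blockCoeff l n * η ^ (n + 1))
        (risingFac r (n + 1) / (n + 1).factorial * η ^ (n + 1)) := by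
    rw [← sum_vl_mul_blockCoeff, Finset.sum_mul]
    refine hasSum_sum_of_ne_finset_zero fun l hl => ?_
    rw [blockCoeff_eq_zero (by simpa using hl)]
    simp
  have habs : Summable fun p : ℕ × ℕ =>
      vl p.2 |r| / p.2.factorial * blockCoeff p.2 p.1 * η ^ (p.1 + 1) := by
    refine (summable_prod_of_nonneg fun p => ?_).mpr ⟨fun n => (fiber |r| n).summable, ?_⟩
    · have := vl_div_factorial_nonneg (abs_nonneg r) p.2
      have := blockCoeff_nonneg p.2 p.1
      positivity
    · simp only [(fiber |r| _).tsum_eq]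
      exact (hasSum_one_sub_rpow_neg |r| h0 h1).summable
  have hsum : Summable fun p : ℕ × ℕ =>
      vl p.2 r / p.2.factorial * blockCoeff p.2 p.1 * η ^ (p.1 + 1) := by
    refine habs.of_norm_bounded fun p => ?_
    have := blockCoeff_nonneg p.2 p.1
    rw [Real.norm_eq_abs, abs_mul, abs_mul, abs_of_nonneg this,
      abs_of_nonneg (by positivity : 0 ≤ η ^ (p.1 + 1))]
    gcongr
    exact abs_vl_div_factorial_le r p.2
  have htot : ∑' p : ℕ × ℕ, vl p.2 r / p.2.factorial * blockCoeff p.2 p.1 * η ^ (p.1 + 1) =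
      (1 - η) ^ (-r) - 1 :=
    (hsum.hasSum.prod_fiberwise (fiber r)).unique (hasSum_one_sub_rpow_neg r h0 h1)
  have hswap := (Equiv.prodComm ℕ ℕ).hasSum_iff.mpr (htot ▸ hsum.hasSum)
  have hl := hswap.prod_fiberwise fun l => (hswap.summable.prod_factor l).hasSum
  convert hl using 2 with l
  have hf := hswap.summable.prod_factor l
  rw [← hf.sum_add_tsum_nat_add l, Finset.sum_eq_zero, zero_add, hyperF, ← tsum_mul_left]
  · refine tsum_congr fun j => ?_
    simp only [Function.comp_apply, Equiv.prodComm_apply, Prod.swap_prod_mk]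
    rw [blockCoeff_add]
    ring
  · intro n hn
    simp [blockCoeff_eq_zero (Finset.mem_range.mp hn)]

/-- Identity (2.8) with η = 1 − w/z: the ground-state expectation value of
the bilocal field expands in the quasiprimary basis,
Σ_i ((1−η)^{−r_i} − 1) = Σ_{l=0}^{∞} (V_l(r⃗)/l!) η^{l+1} ₂F₁(l+1,l+1;2l+2;η),
where V_l(r⃗) = Σ_i v_l(r_i), and the series over l converges. -/
theorem ground_state_expectation_expansion (c : ℕ) (r : Fin c → ℝ) (η : ℝ)
    (h0 : 0 < η) (h1 : η < 1) :
    HasSum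
      (fun l : ℕ =>
        ((∑ i, vl l (r i)) / (Nat.factorial l : ℝ)) * η ^ (l + 1) *
          hyperF ((l : ℝ) + 1) ((l : ℝ) + 1) (2 * (l : ℝ) + 2) η)
      (∑ i, (Real.rpow (1 - η) (-(r i)) - 1)) := by
  have h := hasSum_sum fun (i : Fin c) (_ : i ∈ Finset.univ) => hasSum_vl_block (r i) h0 h1
  simp only [← Finset.sum_mul, ← Finset.sum_div] at h
  exact h
end
end

section
/- For a natural number l ≥ 1 define v_l : ℝ → ℝ by v_l(r) = ((l−1)!·l!/(2l)!) · Σ_{k=0}^{l−1} C(l,k)·C(l,k+1) · r · Π_{i=0}^{l−1} (r − k + i). Then for every integer l ≥ 1, every real r, and every real w > 0: (l!/(2l)!) · ∂₁^l(−∂₂)^l [ (z₁−z₂)^{l−1} ( (z₁/z₂)^r − 1 ) ] evaluated at z₁ = z₂ = w equals v_l(r) · w^{−l−1}. (The computation of the zero-mode eigenvalues (2.10b) by applying the extraction formula (1.20b) to the ground-state expectation value (2.7) of the bilocal field.) -/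
noncomputable section

/-- Partial derivative in the first argument of a function of two real
variables. -/
def pd1 (F : ℝ × ℝ → ℝ) : ℝ × ℝ → ℝ :=
  fun p => deriv (fun x => F (x, p.2)) p.1

/-- Partial derivative in the second argument of a function of two real
variables. -/
def pd2 (F : ℝ × ℝ → ℝ) : ℝ × ℝ → ℝ :=
  fun p => deriv (fun y => F (p.1, y)) p.2

/-- The generalized binomial coefficient `x (x - 1) ⋯ (x - n + 1) / n!`. -/
def realChoose (x : ℝ) (n : ℕ) : ℝ :=
  (∏ i ∈ Finset.range n, (x - (i : ℝ))) / (Nat.factorial n : ℝ)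

lemma realChoose_zero (x : ℝ) : realChoose x 0 = 1 := by simp [realChoose]

lemma prod_sub_eq_factorial_mul_realChoose (x : ℝ) (n : ℕ) :
    ∏ i ∈ Finset.range n, (x - (i : ℝ)) = (Nat.factorial n : ℝ) * realChoose x n := by
  have : (Nat.factorial n : ℝ) ≠ 0 := by positivity
  rw [realChoose]
  field_simp

lemma succ_mul_realChoose_succ (x : ℝ) (n : ℕ) :
    ((n : ℝ) + 1) * realChoose x (n + 1) = (x - n) * realChoose x n := by
  have : (Nat.factorial n : ℝ) ≠ 0 := by positivity
  have : (n : ℝ) + 1 ≠ 0 := by positivity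
  rw [realChoose, realChoose, Finset.prod_range_succ, Nat.factorial_succ]
  push_cast
  field_simp

lemma succ_mul_realChoose_add_one_succ (x : ℝ) (n : ℕ) :
    ((n : ℝ) + 1) * realChoose (x + 1) (n + 1) = (x + 1) * realChoose x n := by
  have : (Nat.factorial n : ℝ) ≠ 0 := by positivity
  have : (n : ℝ) + 1 ≠ 0 := by positivity
  rw [realChoose, realChoose, Finset.prod_range_succ', Nat.factorial_succ]
  push_cast
  simp only [add_sub_add_right_eq_sub, sub_zero]
  field_simp

lemma realChoose_add_one_sub (x : ℝ) (n : ℕ) :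
    realChoose (x + 1) (n + 1) - realChoose x (n + 1) = realChoose x n := by
  have h : (n : ℝ) + 1 ≠ 0 := by positivity
  apply mul_left_cancel₀ h
  rw [mul_sub, succ_mul_realChoose_succ x, succ_mul_realChoose_add_one_succ]
  ring

lemma cast_succ_mul_choose_succ (n k : ℕ) :
    ((k : ℝ) + 1) * (n.choose (k + 1) : ℝ) = ((n : ℝ) - k) * (n.choose k : ℝ) := by
  rcases le_or_gt k n with h | h
  · have := Nat.choose_succ_right_eq n k
    rw [← Nat.cast_sub h]
    have h' : ((n.choose (k + 1) * (k + 1) : ℕ) : ℝ) = ((n.choose k * (n - k) : ℕ) : ℝ) := by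
      rw [this]
    push_cast at h' ⊢
    linarith
  · simp [Nat.choose_eq_zero_of_lt h, Nat.choose_eq_zero_of_lt (Nat.lt_succ_of_lt h)]

/-- The expansion of a product of two binomial coefficients with the same upper argument. -/
lemma realChoose_mul_realChoose (x : ℝ) (m n : ℕ) :
    realChoose x m * realChoose x n =
      ∑ j ∈ Finset.range (m + 1),
        (m.choose j : ℝ) * (n.choose j : ℝ) * realChoose (x + j) (m + n) := by
  induction m with
  | zero => simp [realChoose_zero]
  | succ m ih =>
    have h : (m : ℝ) + 1 ≠ 0 := by positivity
    apply mul_left_cancel₀ h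
    rw [← mul_assoc, succ_mul_realChoose_succ, mul_assoc, ih, Finset.mul_sum, Finset.mul_sum]
    have step : ∀ j : ℕ, (x - m) * ((m.choose j : ℝ) * (n.choose j : ℝ) *
          realChoose (x + j) (m + n)) =
        (m.choose j : ℝ) * (n.choose j : ℝ) * ((m : ℝ) + j + 1) *
            realChoose (x + j) (m + 1 + n) +
          (m.choose j : ℝ) * (n.choose j : ℝ) * ((n : ℝ) - j) *
            realChoose (x + (j + 1 : ℕ)) (m + 1 + n) := by
      intro j
      have h1 := succ_mul_realChoose_succ (x + j) (m + n)
      have h2 := succ_mul_realChoose_add_one_succ (x + j) (m + n)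
      have hN : ((m + n : ℕ) : ℝ) + 1 ≠ 0 := by positivity
      rw [show m + 1 + n = m + n + 1 by ring]
      push_cast at *
      rw [← add_assoc x]
      apply mul_left_cancel₀ hN
      linear_combination (-(m.choose j : ℝ) * (n.choose j : ℝ) * ((m : ℝ) + j + 1)) * h1 -
        ((m.choose j : ℝ) * (n.choose j : ℝ) * ((n : ℝ) - j)) * h2
    rw [Finset.sum_congr rfl fun j _ => step j, Finset.sum_add_distrib,
      Finset.sum_range_succ' _ (m + 1), Finset.sum_range_succ' _ m]
    have top : (m.choose (m + 1) : ℝ) = 0 := by simp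
    have extend : ∑ j ∈ Finset.range m, (m.choose (j + 1) : ℝ) * (n.choose (j + 1) : ℝ) *
          ((m : ℝ) + (j + 1 : ℕ) + 1) * realChoose (x + (j + 1 : ℕ)) (m + 1 + n) =
        ∑ j ∈ Finset.range (m + 1), (m.choose (j + 1) : ℝ) * (n.choose (j + 1) : ℝ) *
          ((m : ℝ) + (j + 1 : ℕ) + 1) * realChoose (x + (j + 1 : ℕ)) (m + 1 + n) := by
      rw [Finset.sum_range_succ, top]
      ring
    rw [extend, add_right_comm, ← Finset.sum_add_distrib]
    congr 1
    · refine Finset.sum_congr rfl fun j _ => ?_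
      have h1 := cast_succ_mul_choose_succ m j
      have h2 := cast_succ_mul_choose_succ n j
      rw [Nat.choose_succ_succ' m j]
      push_cast at *
      linear_combination (-(m.choose j : ℝ) * realChoose (x + (j + 1)) (m + 1 + n)) * h2 +
        ((n.choose (j + 1) : ℝ) * realChoose (x + (j + 1)) (m + 1 + n)) * h1
    · simp

lemma fwdDiff_iter_realChoose (m N : ℕ) (c : ℝ) :
    (fwdDiff (1 : ℝ))^[m] (fun x => realChoose (x + c) (N + m)) =
      fun x => realChoose (x + c) N := by
  induction m with
  | zero => rfl
  | succ m ih =>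
    rw [Function.iterate_succ_apply, ← ih]
    congr 1
    funext x
    rw [fwdDiff, ← add_assoc N, add_right_comm x 1 c, realChoose_add_one_sub]

lemma alternating_sum_realChoose (m N : ℕ) (x : ℝ) :
    ∑ k ∈ Finset.range (m + 1), (-1 : ℝ) ^ (m - k) * (m.choose k : ℝ) *
      realChoose (x + k) (N + m) = realChoose x N := by
  have h := fwdDiff_iter_eq_sum_shift (1 : ℝ) (fun x => realChoose (x + 0) (N + m)) m x
  rw [fwdDiff_iter_realChoose] at h
  simp only [add_zero] at h
  rw [h]
  refine Finset.sum_congr rfl fun k _ => ?_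
  simp

lemma alternating_sum_realChoose_sq (m : ℕ) (r : ℝ) :
    ∑ k ∈ Finset.range (m + 1), (-1 : ℝ) ^ (m - k) * (m.choose k : ℝ) *
        realChoose (r + k) (m + 1) ^ 2 =
      ∑ j ∈ Finset.range (m + 2), ((m + 1).choose j : ℝ) ^ 2 * realChoose (r + j) (m + 2) := by
  have h : ∀ k : ℕ, (-1 : ℝ) ^ (m - k) * (m.choose k : ℝ) * realChoose (r + k) (m + 1) ^ 2 =
      ∑ j ∈ Finset.range (m + 2), ((m + 1).choose j : ℝ) ^ 2 *
        ((-1 : ℝ) ^ (m - k) * (m.choose k : ℝ) * realChoose (r + j + k) (m + 2 + m)) := by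
    intro k
    rw [sq, realChoose_mul_realChoose, Finset.mul_sum]
    refine Finset.sum_congr rfl fun j _ => ?_
    rw [show m + 1 + (m + 1) = m + 2 + m by ring, add_right_comm r]
    ring
  rw [Finset.sum_congr rfl fun k _ => h k, Finset.sum_comm]
  refine Finset.sum_congr rfl fun j _ => ?_
  rw [← Finset.mul_sum, alternating_sum_realChoose]

lemma sum_narayana_mul_realChoose (m : ℕ) (r : ℝ) :
    ∑ j ∈ Finset.range (m + 1), ((m + 1).choose (j + 1) : ℝ) * ((m + 1).choose j : ℝ) * r *
        realChoose (r + j) (m + 1) =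
      ((m : ℝ) + 1) * ∑ j ∈ Finset.range (m + 2),
        ((m + 1).choose j : ℝ) ^ 2 * realChoose (r + j) (m + 2) := by
  have step : ∀ j : ℕ, ((m + 1).choose (j + 1) : ℝ) * ((m + 1).choose j : ℝ) * r *
        realChoose (r + j) (m + 1) =
      ((m + 1).choose j : ℝ) ^ 2 * ((m : ℝ) + 1 - j) * realChoose (r + j) (m + 2) +
        ((m + 1).choose (j + 1) : ℝ) ^ 2 * (j + 1 : ℕ) *
          realChoose (r + (j + 1 : ℕ)) (m + 2) := by
    intro j
    have h1 := succ_mul_realChoose_succ (r + j) (m + 1)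
    have h2 := succ_mul_realChoose_add_one_succ (r + j) (m + 1)
    have h3 := cast_succ_mul_choose_succ (m + 1) j
    have hN : ((m + 1 : ℕ) : ℝ) + 1 ≠ 0 := by positivity
    push_cast at *
    rw [← add_assoc r]
    apply mul_left_cancel₀ hN
    generalize ((m + 1).choose (j + 1) : ℝ) = a at *
    generalize ((m + 1).choose j : ℝ) = b at *
    generalize realChoose (r + j) (m + 1) = p at *
    generalize realChoose (r + j) (m + 1 + 1) = q at *
    generalize realChoose (r + j + 1) (m + 1 + 1) = s at *
    linear_combination (-b ^ 2 * ((m : ℝ) + 1 - j)) * h1 - (a ^ 2 * (j + 1)) * h2 +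
      (b * (r + j - (m + 1)) - a * (r + j + 1)) * p * h3
  rw [Finset.sum_congr rfl fun j _ => step j, Finset.sum_add_distrib]
  have e1 : ∑ j ∈ Finset.range (m + 1),
        ((m + 1).choose j : ℝ) ^ 2 * ((m : ℝ) + 1 - j) * realChoose (r + j) (m + 2) =
      ∑ j ∈ Finset.range (m + 2),
        ((m + 1).choose j : ℝ) ^ 2 * ((m : ℝ) + 1 - j) * realChoose (r + j) (m + 2) := by
    rw [Finset.sum_range_succ _ (m + 1)]
    push_cast
    ring
  have e2 : ∑ j ∈ Finset.range (m + 1), ((m + 1).choose (j + 1) : ℝ) ^ 2 * (j + 1 : ℕ) *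
          realChoose (r + (j + 1 : ℕ)) (m + 2) =
      ∑ j ∈ Finset.range (m + 2),
        ((m + 1).choose j : ℝ) ^ 2 * (j : ℝ) * realChoose (r + j) (m + 2) := by
    rw [Finset.sum_range_succ' _ (m + 1)]
    simp
  rw [e1, e2, ← Finset.sum_add_distrib, Finset.mul_sum]
  refine Finset.sum_congr rfl fun j _ => ?_
  ring

lemma prod_sub_add_eq (x : ℝ) (m : ℕ) :
    ∏ i ∈ Finset.range (m + 1), (x - (m : ℝ) + (i : ℝ)) =
      ∏ i ∈ Finset.range (m + 1), (x - (i : ℝ)) := by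
  rw [← Finset.prod_range_reflect]
  refine Finset.prod_congr rfl fun i hi => ?_
  have : i ≤ m := Nat.lt_succ_iff.mp (Finset.mem_range.mp hi)
  rw [show m + 1 - 1 - i = m - i by omega, Nat.cast_sub this]
  ring

lemma vl_succ_eq_alternating_sum (m : ℕ) (r : ℝ) :
    vl (m + 1) r = (Nat.factorial (m + 1) : ℝ) / (Nat.factorial (2 * (m + 1)) : ℝ) *
      ∑ j ∈ Finset.range (m + 1), (-1 : ℝ) ^ (m - j) * (m.choose j : ℝ) *
        (∏ i ∈ Finset.range (m + 1), (r + j - (i : ℝ))) ^ 2 := by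
  have h1 : ∑ k ∈ Finset.range (m + 1),
      ((m + 1).choose k : ℝ) * ((m + 1).choose (k + 1) : ℝ) * r *
        ∏ i ∈ Finset.range (m + 1), (r - (k : ℝ) + (i : ℝ)) =
      (Nat.factorial (m + 1) : ℝ) * ∑ j ∈ Finset.range (m + 1),
        ((m + 1).choose (j + 1) : ℝ) * ((m + 1).choose j : ℝ) * r *
          realChoose (r + j) (m + 1) := by
    rw [← Finset.sum_range_reflect, Finset.mul_sum]
    refine Finset.sum_congr rfl fun j hj => ?_
    have hj' : j ≤ m := Nat.lt_succ_iff.mp (Finset.mem_range.mp hj)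
    rw [show m + 1 - 1 - j = m - j by omega, Nat.cast_sub hj',
      show r - ((m : ℝ) - j) = r + j - m by ring, prod_sub_add_eq,
      prod_sub_eq_factorial_mul_realChoose,
      ← Nat.choose_symm (show m - j ≤ m + 1 by omega),
      ← Nat.choose_symm (show m - j + 1 ≤ m + 1 by omega),
      show m + 1 - (m - j) = j + 1 by omega, show m + 1 - (m - j + 1) = j by omega]
    ring
  simp only [vl, h1, sum_narayana_mul_realChoose, prod_sub_eq_factorial_mul_realChoose, mul_pow]
  rw [← alternating_sum_realChoose_sq, Nat.factorial_succ]
  simp only [Finset.mul_sum]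
  refine Finset.sum_congr rfl fun j _ => ?_
  push_cast
  ring

lemma hasDerivAt_sum_mul_rpow {ι : Type*} (s : Finset ι) (c b : ι → ℝ) {y : ℝ} (hy : 0 < y) :
    HasDerivAt (fun y : ℝ => ∑ i ∈ s, c i * y ^ b i) (∑ i ∈ s, c i * b i * y ^ (b i - 1)) y := by
  refine HasDerivAt.fun_sum fun i _ => ?_
  rw [mul_assoc]
  exact (Real.hasDerivAt_rpow_const (Or.inl hy.ne')).const_mul _

lemma pd2_eq_of_eq_sum_rpow {ι : Type*} (s : Finset ι) (c a b : ι → ℝ) {F : ℝ × ℝ → ℝ}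
    (hF : ∀ x y : ℝ, 0 < x → 0 < y → F (x, y) = ∑ i ∈ s, c i * x ^ a i * y ^ b i)
    (x y : ℝ) (hx : 0 < x) (hy : 0 < y) :
    pd2 F (x, y) = ∑ i ∈ s, c i * b i * x ^ a i * y ^ (b i - 1) := by
  have h := hasDerivAt_sum_mul_rpow s (fun i => c i * x ^ a i) b hy
  have e : (fun y => F (x, y)) =ᶠ[nhds y] fun y => ∑ i ∈ s, c i * x ^ a i * y ^ b i := by
    filter_upwards [lt_mem_nhds hy] with z hz using hF x z hx hz
  rw [pd2, e.deriv_eq, h.deriv]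
  exact Finset.sum_congr rfl fun i _ => by ring

lemma pd1_eq_of_eq_sum_rpow {ι : Type*} (s : Finset ι) (c a b : ι → ℝ) {F : ℝ × ℝ → ℝ}
    (hF : ∀ x y : ℝ, 0 < x → 0 < y → F (x, y) = ∑ i ∈ s, c i * x ^ a i * y ^ b i)
    (x y : ℝ) (hx : 0 < x) (hy : 0 < y) :
    pd1 F (x, y) = ∑ i ∈ s, c i * a i * x ^ (a i - 1) * y ^ b i := by
  have h := hasDerivAt_sum_mul_rpow s (fun i => c i * y ^ b i) a hx
  have e : (fun x => F (x, y)) =ᶠ[nhds x] fun x => ∑ i ∈ s, c i * y ^ b i * x ^ a i := by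
    filter_upwards [lt_mem_nhds hx] with z hz
    rw [hF z y hz hy]
    exact Finset.sum_congr rfl fun i _ => by ring
  rw [pd1, e.deriv_eq, h.deriv]
  exact Finset.sum_congr rfl fun i _ => by ring

lemma pd2_iterate_eq_of_eq_sum_rpow {ι : Type*} (s : Finset ι) (c a b : ι → ℝ) {F : ℝ × ℝ → ℝ}
    (hF : ∀ x y : ℝ, 0 < x → 0 < y → F (x, y) = ∑ i ∈ s, c i * x ^ a i * y ^ b i) (n : ℕ) :
    ∀ x y : ℝ, 0 < x → 0 < y → pd2^[n] F (x, y) =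
      ∑ i ∈ s, (c i * ∏ t ∈ Finset.range n, (b i - (t : ℝ))) * x ^ a i * y ^ (b i - n) := by
  induction n with
  | zero => simpa using hF
  | succ n ih =>
    intro x y hx hy
    rw [Function.iterate_succ_apply', pd2_eq_of_eq_sum_rpow s _ _ _ ih x y hx hy]
    refine Finset.sum_congr rfl fun i _ => ?_
    rw [Finset.prod_range_succ, sub_sub]
    push_cast
    ring

lemma pd1_iterate_eq_of_eq_sum_rpow {ι : Type*} (s : Finset ι) (c a b : ι → ℝ) {F : ℝ × ℝ → ℝ}
    (hF : ∀ x y : ℝ, 0 < x → 0 < y → F (x, y) = ∑ i ∈ s, c i * x ^ a i * y ^ b i) (n : ℕ) :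
    ∀ x y : ℝ, 0 < x → 0 < y → pd1^[n] F (x, y) =
      ∑ i ∈ s, (c i * ∏ t ∈ Finset.range n, (a i - (t : ℝ))) * x ^ (a i - n) * y ^ b i := by
  induction n with
  | zero => simpa using hF
  | succ n ih =>
    intro x y hx hy
    rw [Function.iterate_succ_apply', pd1_eq_of_eq_sum_rpow s _ _ _ ih x y hx hy]
    refine Finset.sum_congr rfl fun i _ => ?_
    rw [Finset.prod_range_succ, sub_sub]
    push_cast
    ring

lemma sub_pow_mul_rpow_div_sub_one_eq_sum (m : ℕ) (r x y : ℝ) (hx : 0 < x) (hy : 0 < y) :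
    (x - y) ^ m * (Real.rpow (x / y) r - 1) =
      ∑ i ∈ Finset.range (m + 1) ×ˢ (Finset.univ : Finset Bool),
        ((-1 : ℝ) ^ (m - i.1) * (m.choose i.1 : ℝ) * (if i.2 then 1 else -1)) *
          x ^ ((i.1 : ℝ) + if i.2 then r else 0) *
          y ^ (((m : ℝ) - i.1) - if i.2 then r else 0) := by
  have hr : Real.rpow (x / y) r = x ^ r * y ^ (-r) := by
    rw [Real.rpow_neg hy.le, ← div_eq_mul_inv, ← Real.div_rpow hx.le hy.le]
    rfl
  rw [hr, sub_eq_add_neg x, add_pow, Finset.sum_product, Finset.sum_mul]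
  refine Finset.sum_congr rfl fun j hj => ?_
  have hj' : j ≤ m := Nat.lt_succ_iff.mp (Finset.mem_range.mp hj)
  simp only [Fintype.sum_bool, if_true, Bool.false_eq_true, if_false, add_zero, sub_zero]
  rw [← Nat.cast_sub hj']
  rw [Real.rpow_add hx, sub_eq_add_neg _ r, Real.rpow_add hy, Real.rpow_natCast,
    Real.rpow_natCast, neg_pow]
  ring

lemma prod_natCast_sub_eq_zero {j n : ℕ} (h : j < n) :
    ∏ i ∈ Finset.range n, ((j : ℝ) - (i : ℝ)) = 0 :=
  Finset.prod_eq_zero (Finset.mem_range.mpr h) (sub_self _)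

lemma neg_one_pow_mul_prod_sub (m : ℕ) (x : ℝ) :
    (-1 : ℝ) ^ (m + 1) * ∏ i ∈ Finset.range (m + 1), ((m : ℝ) - x - (i : ℝ)) =
      ∏ i ∈ Finset.range (m + 1), (x - (i : ℝ)) := by
  have h : (-1 : ℝ) ^ (m + 1) = ∏ _i ∈ Finset.range (m + 1), (-1 : ℝ) := by simp
  rw [← prod_sub_add_eq, h, ← Finset.prod_mul_distrib]
  exact Finset.prod_congr rfl fun i _ => by ring

/-- The computation of the zero-mode eigenvalues (2.10b) by applying the
extraction formula (1.20b) to the ground-state expectation value (2.7):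
(l!/(2l)!) ∂₁^l(−∂₂)^l[(z₁−z₂)^{l−1}((z₁/z₂)^r − 1)] |_{z₁=z₂=w}
  = v_l(r) w^{−l−1} for l ≥ 1 and w > 0. -/
theorem zero_mode_eigenvalue_extraction (l : ℕ) (hl : 1 ≤ l) (r w : ℝ)
    (hw : 0 < w) :
    ((Nat.factorial l : ℝ) / (Nat.factorial (2 * l) : ℝ)) *
        ((-1 : ℝ) ^ l *
          (pd1^[l] (pd2^[l] fun p : ℝ × ℝ =>
            (p.1 - p.2) ^ (l - 1) * (Real.rpow (p.1 / p.2) r - 1))) (w, w)) =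
      vl l r * w ^ (-(l : ℤ) - 1) := by
  obtain ⟨m, rfl⟩ : ∃ m, l = m + 1 := ⟨l - 1, by omega⟩
  have h2 := pd2_iterate_eq_of_eq_sum_rpow _ _ _ _
    (F := fun p : ℝ × ℝ => (p.1 - p.2) ^ m * (Real.rpow (p.1 / p.2) r - 1))
    (sub_pow_mul_rpow_div_sub_one_eq_sum m r) (m + 1)
  have h1 := pd1_iterate_eq_of_eq_sum_rpow _ _ _ _ h2 (m + 1) w w hw hw
  rw [Nat.add_sub_cancel, h1, vl_succ_eq_alternating_sum, mul_assoc, Finset.sum_product,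
    Finset.mul_sum, Finset.sum_mul]
  congr 1
  refine Finset.sum_congr rfl fun j hj => ?_
  have hj' : j < m + 1 := Finset.mem_range.mp hj
  simp only [Fintype.sum_bool, if_true, Bool.false_eq_true, if_false, add_zero,
    prod_natCast_sub_eq_zero hj']
  have hpow : w ^ ((j : ℝ) + r - (m + 1 : ℕ)) * w ^ ((m : ℝ) - j - r - (m + 1 : ℕ)) =
      w ^ (-((m + 1 : ℕ) : ℤ) - 1) := by
    rw [← Real.rpow_add hw, ← Real.rpow_intCast]
    congr 1
    push_cast
    ring
  have hprod := neg_one_pow_mul_prod_sub m (r + j)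
  rw [show (m : ℝ) - (r + j) = m - j - r by ring] at hprod
  rw [← hpow, sq]
  nth_rewrite 1 [← hprod]
  rw [add_comm r (j : ℝ)]
  ring
end
end

section
/- For all natural numbers l, l′ and all real numbers z ≠ w, one has ∂₁^l(−∂₂)^l [ (z₁−z₂)^{l+l′} / ((z₁−w)(z₂−w))^{l′+1} ] evaluated at z₁ = z₂ = z equal to (2l)! · (z−w)^{−2l−2} if l = l′, and equal to 0 if l ≠ l′. Equivalently, applying the normalized extraction (l!/(2l)!)·∂₁^l(−∂₂)^l[(z₁−z₂)^l · — ] at coincident points to the 3-point function l′!·C(2l′,l′)^{−1}·c·(z₁−z₂)^{l′}/((z₁−w)(z₂−w))^{l′+1} yields the orthonormalization c·((l!)⁴/(2l)!)·(z−w)^{−2l−2}·δ_{l l′} of the quasiprimary fields V^l stated in formula (1.18). -/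
noncomputable section

open Finset Polynomial Topology

lemma pd1_iterate_apply (F : ℝ × ℝ → ℝ) (n : ℕ) (p : ℝ × ℝ) :
    (pd1^[n] F) p = iteratedDeriv n (fun x => F (x, p.2)) p.1 := by
  induction n generalizing F with
  | zero => simp
  | succ n ih => rw [Function.iterate_succ_apply, ih, iteratedDeriv_succ']; rfl

lemma pd2_iterate_apply (F : ℝ × ℝ → ℝ) (n : ℕ) (p : ℝ × ℝ) :
    (pd2^[n] F) p = iteratedDeriv n (fun y => F (p.1, y)) p.2 := by
  induction n generalizing F with
  | zero => simp
  | succ n ih => rw [Function.iterate_succ_apply, ih, iteratedDeriv_succ']; rfl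

/-- Iterated derivatives of a function that agrees, away from `w`, with a Laurent polynomial
in `x - w`. -/
lemma iteratedDeriv_eq_sum_zpow {ι : Type*} {f : ℝ → ℝ} {w x : ℝ} (s : Finset ι) (c : ι → ℝ)
    (m : ι → ℤ) (hf : ∀ y, y ≠ w → f y = ∑ k ∈ s, c k * (y - w) ^ m k) (hx : x ≠ w) (n : ℕ) :
    iteratedDeriv n f x =
      ∑ k ∈ s, c k * ((∏ i ∈ range n, ((m k : ℝ) - i)) * (x - w) ^ (m k - n)) := by
  have hfe : f =ᶠ[𝓝 x] fun y => ∑ k ∈ s, c k * (y - w) ^ m k := by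
    filter_upwards [isOpen_ne.mem_nhds hx] with y hy using hf y hy
  rw [hfe.iteratedDeriv_eq, iteratedDeriv_fun_sum]
  · refine sum_congr rfl fun k _ => ?_
    rw [iteratedDeriv_const_mul_field, iteratedDeriv_comp_sub_const n (fun y : ℝ => y ^ m k) w,
      iteratedDeriv_eq_iterate, iter_deriv_zpow']
  · intro k _
    have hsub : ContDiffAt ℝ n (fun y : ℝ => y - w) x := by fun_prop
    refine contDiffAt_const.mul ?_
    rcases m k with j | j
    · simpa using hsub.pow j
    · simp only [zpow_negSucc]
      exact (hsub.pow (j + 1)).inv (pow_ne_zero _ (sub_ne_zero.2 hx))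

lemma sub_pow_div_mul_pow_eq_sum_zpow {x y w : ℝ} (hx : x ≠ w) (hy : y ≠ w) (N d : ℕ) :
    (x - y) ^ N / ((x - w) * (y - w)) ^ d =
      ∑ k ∈ range (N + 1), (-1) ^ (N - k) * (N.choose k : ℝ) * (x - w) ^ ((k : ℤ) - d) *
        (y - w) ^ ((N : ℤ) - k - d) := by
  have hx' := sub_ne_zero.2 hx
  have hy' := sub_ne_zero.2 hy
  rw [show x - y = (x - w) + -(y - w) by ring, add_pow, sum_div]
  refine sum_congr rfl fun k hk => ?_
  have hkN : k ≤ N := Nat.lt_succ_iff.1 (mem_range.1 hk)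
  rw [zpow_sub₀ hx', zpow_sub₀ hy', ← Nat.cast_sub hkN, neg_pow (y - w), mul_pow (x - w)]
  simp only [zpow_natCast]
  field_simp

/-- Up to sign, the monic polynomial in `k` produced by differentiating
`(x - w) ^ (k - l' - 1) * (y - w) ^ (l - k - 1)` `l` times in each variable. -/
def mixedDerivPoly (l l' : ℕ) : ℝ[X] :=
  ∏ i ∈ range l, ((X - C ((l' : ℝ) + 1 + i)) * (X - C ((l : ℝ) - 1 - i)))

lemma mixedDerivPoly_monic (l l' : ℕ) : (mixedDerivPoly l l').Monic :=
  monic_prod_of_monic _ _ fun _ _ => (monic_X_sub_C _).mul (monic_X_sub_C _)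

lemma natDegree_mixedDerivPoly (l l' : ℕ) : (mixedDerivPoly l l').natDegree = 2 * l := by
  rw [mixedDerivPoly, natDegree_prod_of_monic _ _
    fun _ _ => (monic_X_sub_C _).mul (monic_X_sub_C _)]
  simp only [(monic_X_sub_C _).natDegree_mul (monic_X_sub_C _), natDegree_X_sub_C]
  simp [mul_comm]

lemma neg_one_pow_mul_prod_mul_prod (l l' k : ℕ) :
    (-1 : ℝ) ^ l * ((∏ i ∈ range l, ((k : ℝ) - (l' + 1) - i)) *
      ∏ i ∈ range l, ((l : ℝ) - k - 1 - i)) = (mixedDerivPoly l l').eval (k : ℝ) := by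
  nth_rw 1 [← card_range l]
  rw [mixedDerivPoly, eval_prod, ← prod_mul_distrib, ← prod_const, ← prod_mul_distrib]
  refine prod_congr rfl fun i _ => ?_
  simp only [eval_mul, eval_sub, eval_X, eval_C]
  ring

lemma eval_mixedDerivPoly_eq_zero {l l' k : ℕ} (hl : l' < l) (hk : k ≤ l + l') :
    (mixedDerivPoly l l').eval (k : ℝ) = 0 := by
  rw [mixedDerivPoly, eval_prod]
  rcases le_or_gt k l' with h | h
  · refine prod_eq_zero (i := l - 1 - k) (mem_range.2 (by omega)) ?_
    rw [Nat.cast_sub (by omega), Nat.cast_sub (by omega)]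
    simp
  · refine prod_eq_zero (i := k - (l' + 1)) (mem_range.2 (by omega)) ?_
    rw [Nat.cast_sub (by omega)]
    simp

lemma sum_choose_mul_eval_mixedDerivPoly (l l' : ℕ) :
    ∑ k ∈ range (l + l' + 1), (-1) ^ (l + l' - k) * ((l + l').choose k : ℝ) *
      (mixedDerivPoly l l').eval (k : ℝ) = if l = l' then ((2 * l).factorial : ℝ) else 0 := by
  have hΔ : (fwdDiff (1 : ℝ))^[l + l'] (mixedDerivPoly l l').eval 0 =
      ∑ k ∈ range (l + l' + 1), (-1) ^ (l + l' - k) * ((l + l').choose k : ℝ) *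
        (mixedDerivPoly l l').eval (k : ℝ) := by
    simp [fwdDiff_iter_eq_sum_shift]
  rcases lt_trichotomy l l' with h | rfl | h
  · rw [← hΔ, fwdDiff_iter_eq_zero_of_degree_lt (by rw [natDegree_mixedDerivPoly]; omega),
      if_neg h.ne, Pi.zero_apply]
  · rw [← hΔ, ← two_mul, if_pos rfl]
    have h := congr_fun (mixedDerivPoly l l).fwdDiff_iter_degree_eq_factorial 0
    rw [natDegree_mixedDerivPoly, (mixedDerivPoly_monic l l).leadingCoeff, one_smul] at h
    simpa using h
  · rw [if_neg h.ne']
    refine sum_eq_zero fun k hk => ?_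
    rw [eval_mixedDerivPoly_eq_zero h (Nat.lt_succ_iff.1 (mem_range.1 hk)), mul_zero]

/-- Applying ∂₁^l(−∂₂)^l to
(z₁,z₂) ↦ (z₁−z₂)^{l+l′}/((z₁−w)(z₂−w))^{l′+1} and setting z₁ = z₂ = z gives
(2l)!(z−w)^{−2l−2} if l = l′ and 0 otherwise: the orthonormalization (1.18)
of the quasiprimary fields V^l extracted from the 3-point function (1.19). -/
theorem quasiprimary_orthonormalization (l l' : ℕ) (z w : ℝ) (hzw : z ≠ w) :
    (-1 : ℝ) ^ l *
        (pd1^[l] (pd2^[l] fun p : ℝ × ℝ =>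
          (p.1 - p.2) ^ (l + l') / ((p.1 - w) * (p.2 - w)) ^ (l' + 1))) (z, z) =
      if l = l' then (Nat.factorial (2 * l) : ℝ) / (z - w) ^ (2 * l + 2)
      else 0 := by
  rw [pd1_iterate_apply]
  simp only [pd2_iterate_apply]
  rw [iteratedDeriv_eq_sum_zpow (w := w) (range (l + l' + 1))
    (fun k => (-1) ^ (l + l' - k) * ((l + l').choose k : ℝ) *
      ((∏ i ∈ range l, ((((l + l' : ℕ) : ℤ) - k - (l' + 1 : ℕ) : ℤ) - i : ℝ)) *
        (z - w) ^ (((l + l' : ℕ) : ℤ) - k - (l' + 1 : ℕ) - l)))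
    (fun k => (k : ℤ) - (l' + 1 : ℕ)) ?_ hzw l]
  · have hzw' := sub_ne_zero.2 hzw
    have hsum := sum_choose_mul_eval_mixedDerivPoly l l'
    trans (∑ k ∈ range (l + l' + 1), (-1) ^ (l + l' - k) * ((l + l').choose k : ℝ) *
      (mixedDerivPoly l l').eval (k : ℝ)) * ((z - w) ^ (l + l' + 2))⁻¹
    · rw [mul_sum, sum_mul]
      refine sum_congr rfl fun k _ => ?_
      have hpow : (z - w) ^ (((l + l' : ℕ) : ℤ) - k - (l' + 1 : ℕ) - l) *
          (z - w) ^ ((k : ℤ) - (l' + 1 : ℕ) - l) = ((z - w) ^ (l + l' + 2))⁻¹ := by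
        rw [← zpow_add₀ hzw', ← zpow_natCast, ← zpow_neg]
        congr 1
        push_cast
        ring
      rw [← hpow, ← neg_one_pow_mul_prod_mul_prod]
      have hexp : (((l + l' : ℕ) : ℤ) - k - (l' + 1 : ℕ) : ℤ) = (l : ℤ) - k - 1 := by
        push_cast
        ring
      rw [hexp]
      push_cast
      ring
    · rw [hsum]
      split_ifs with h
      · subst h
        rw [div_eq_mul_inv, two_mul]
      · rw [zero_mul]
  · intro x hx
    rw [iteratedDeriv_eq_sum_zpow (w := w) (range (l + l' + 1))
      (fun k => (-1) ^ (l + l' - k) * ((l + l').choose k : ℝ) *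
        (x - w) ^ ((k : ℤ) - (l' + 1 : ℕ)))
      (fun k => ((l + l' : ℕ) : ℤ) - k - (l' + 1 : ℕ))
      (fun y hy => sub_pow_div_mul_pow_eq_sum_zpow hx hy _ _) hzw l]
    exact sum_congr rfl fun k _ => by ring
end
end
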